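/- Deterministic pointwise bias reduction: let ĝ ∈ ℝ^d with ĝ ≠ 0, u = ĝ/‖ĝ‖, and let b = η B ĝ + r for scalars η ≥ 0, a matrix B, a vector r, and suppose ĝᵀBĝ ≥ λ‖ĝ‖² for some λ ≥ 0. Then ‖b − ⟨b, u⟩u‖² ≤ ‖b‖² − η² λ² ‖ĝ‖² + 2 η λ ‖ĝ‖ ‖r‖. -/

import Mathlib

open scoped RealInnerProductSpace

/-- Removing the component of `b` along a unit vector `u` lowers the squared norm by `⟪b, u⟫ ^ 2`. -/
theorem norm_sub_inner_smul_sq {E : Type*} [NormedAddCommGroup E] [InnerProductSpace ℝ E]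
    (b : E) {u : E} (hu : ‖u‖ = 1) :
    ‖b - ⟪b, u⟫ • u‖ ^ 2 = ‖b‖ ^ 2 - ⟪b, u⟫ ^ 2 := by
  rw [norm_sub_sq_real, real_inner_smul_right, norm_smul, hu, Real.norm_eq_abs, mul_one, sq_abs]
  ring

theorem stmt5 {d : ℕ} (g r : EuclideanSpace ℝ (Fin d)) (hg : g ≠ 0)
    (u : EuclideanSpace ℝ (Fin d)) (hu : u = ‖g‖⁻¹ • g)
    (η lam : ℝ) (hη : 0 ≤ η) (hlam : 0 ≤ lam)
    (B : EuclideanSpace ℝ (Fin d) →ₗ[ℝ] EuclideanSpace ℝ (Fin d))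
    (b : EuclideanSpace ℝ (Fin d)) (hb : b = η • B g + r)
    (hpers : lam * ‖g‖ ^ 2 ≤ ⟪g, B g⟫) :
    ‖b - ⟪b, u⟫ • u‖ ^ 2
      ≤ ‖b‖ ^ 2 - η ^ 2 * lam ^ 2 * ‖g‖ ^ 2 + 2 * η * lam * ‖g‖ * ‖r‖ := by
  have hg_pos : 0 < ‖g‖ := norm_pos_iff.mpr hg
  have hu_norm : ‖u‖ = 1 := by
    rw [hu, norm_smul, norm_inv, norm_norm, inv_mul_cancel₀ hg_pos.ne']
  have h_signal : lam * ‖g‖ ≤ ⟪B g, u⟫ := by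
    rw [hu, real_inner_smul_right, real_inner_comm, inv_mul_eq_div, le_div_iff₀ hg_pos]
    linarith
  have h_noise : -‖r‖ ≤ ⟪r, u⟫ := by
    have h := abs_real_inner_le_norm r u
    rw [hu_norm, mul_one] at h
    exact (abs_le.mp h).1
  have h_inner : η * (lam * ‖g‖) - ‖r‖ ≤ ⟪b, u⟫ := by
    rw [hb, inner_add_left, real_inner_smul_left]
    linarith [mul_le_mul_of_nonneg_left h_signal hη]
  have ht : 0 ≤ η * (lam * ‖g‖) := by positivity
  rw [norm_sub_inner_smul_sq b hu_norm]
  linarith [mul_le_mul_of_nonneg_left h_inner ht, sq_nonneg (⟪b, u⟫ - η * (lam * ‖g‖))]
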